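/- Let g be a C^∞ function on Δ with everywhere positive definite Hessian satisfying g(x) = log det(½∇²g(x)) for all x ∈ Δ and g(x) → +∞ as x approaches any boundary point of Δ. Then for every boundary point x⁰ ∈ ∂Δ that is not a vertex (i.e. x⁰ ∉ {0, e₁, …, e_d}), the smallest eigenvalue of the Hessian of g stays bounded near x⁰: there exist C > 0 and δ > 0 such that for every x ∈ Δ with |x − x⁰| < δ one has λ_min(∇²g(x)) ≤ C, where λ_min(A) := inf{v^⊤ A v : v ∈ ℝ^d, |v| = 1}. -/

import Mathlib

open Real Filter MeasureTheory
open scoped Matrix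

noncomputable section

/-- The open subprobability simplex in `ℝ^d`. -/
def simplexΔ (d : ℕ) : Set (Fin d → ℝ) := {x | (∀ i, 0 < x i) ∧ ∑ i, x i < 1}

/-- Hessian matrix of `u` at `x` (entries `∂²u/∂xᵢ∂xⱼ`). -/
def hess (d : ℕ) (u : (Fin d → ℝ) → ℝ) (x : Fin d → ℝ) : Matrix (Fin d) (Fin d) ℝ :=
  Matrix.of fun i j => fderiv ℝ (fun y => fderiv ℝ u y (Pi.single j 1)) x (Pi.single i 1)

/-- The barrier function `w(x) = -2∑ log xᵢ - 2 log(1-∑xᵢ)`. -/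
def wbar (d : ℕ) (x : Fin d → ℝ) : ℝ :=
  -2 * ∑ i, Real.log (x i) - 2 * Real.log (1 - ∑ i, x i)

/-- Gradient of `u` at `x`. -/
def gradv (d : ℕ) (u : (Fin d → ℝ) → ℝ) (x : Fin d → ℝ) : Fin d → ℝ :=
  fun i => fderiv ℝ u x (Pi.single i 1)

/-- Smallest eigenvalue of a symmetric matrix, as the infimum of the Rayleigh
quotient over Euclidean unit vectors. -/
def lamMin (d : ℕ) (A : Matrix (Fin d) (Fin d) ℝ) : ℝ :=
  sInf {r | ∃ v : Fin d → ℝ, ∑ i, v i ^ 2 = 1 ∧ r = v ⬝ᵥ A.mulVec v}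

section Matrices

open scoped MatrixOrder Topology

variable {n : Type*} [Fintype n] [DecidableEq n]

/-- A positive definite matrix becomes the identity in a suitable basis. -/
lemma Matrix.PosDef.exists_frame {A : Matrix n n ℝ} (hA : A.PosDef) :
    ∃ F : Matrix n n ℝ, IsUnit F ∧ Fᵀ * A * F = 1 := by
  obtain ⟨B, hB, rfl⟩ := CStarAlgebra.isStrictlyPositive_iff_eq_star_mul_self.mp
    hA.isStrictlyPositive
  have hdet : IsUnit B.det := (Matrix.isUnit_iff_isUnit_det B).1 hB
  refine ⟨B⁻¹, by simpa using hB, ?_⟩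
  rw [Matrix.star_eq_conjTranspose, Matrix.conjTranspose_eq_transpose_of_trivial,
    Matrix.transpose_nonsing_inv, mul_assoc, mul_assoc, Matrix.mul_nonsing_inv _ hdet, mul_one,
    Matrix.nonsing_inv_mul]
  simpa using hdet

/-- Determinants are monotone on positive semidefinite matrices. -/
lemma Matrix.PosDef.det_le_det {A U : Matrix n n ℝ} (hA : A.PosDef) (hU : U.PosSemidef)
    (h : (A - U).PosSemidef) : U.det ≤ A.det := by
  obtain ⟨F, hF, hFA⟩ := hA.exists_frame
  have hV : (Fᵀ * U * F).PosSemidef := by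
    simpa [Matrix.conjTranspose_eq_transpose_of_trivial] using hU.conjTranspose_mul_mul_same F
  have hW : (1 - Fᵀ * U * F).PosSemidef := by
    have := h.conjTranspose_mul_mul_same F
    rwa [Matrix.conjTranspose_eq_transpose_of_trivial, mul_sub, sub_mul, hFA] at this
  have h1 : (Fᵀ * U * F).det ≤ 1 := by
    rw [hV.1.det_eq_prod_eigenvalues]
    refine Finset.prod_le_one (fun i _ => hV.eigenvalues_nonneg i) fun i _ => ?_
    have hv := hW.dotProduct_mulVec_nonneg (hV.1.eigenvectorBasis i).ofLp
    rw [Matrix.sub_mulVec, Matrix.one_mulVec, hV.1.mulVec_eigenvectorBasis, dotProduct_sub,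
      dotProduct_smul] at hv
    have hn : star (hV.1.eigenvectorBasis i).ofLp ⬝ᵥ (hV.1.eigenvectorBasis i).ofLp = 1 := by
      have := real_inner_self_eq_norm_sq (hV.1.eigenvectorBasis i)
      rw [hV.1.eigenvectorBasis.orthonormal.1 i] at this
      rw [PiLp.inner_apply] at this
      simpa [dotProduct, sq] using this
    rw [hn] at hv
    simpa using hv
  have h2 : F.det * F.det * A.det = 1 := by
    have := congrArg Matrix.det hFA
    simp only [Matrix.det_mul, Matrix.det_transpose, Matrix.det_one] at this
    linarith
  have h3 : F.det * F.det * U.det ≤ 1 := by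
    simp only [Matrix.det_mul, Matrix.det_transpose] at h1
    linarith
  have h4 : 0 < F.det * F.det :=
    mul_self_pos.2 ((Matrix.isUnit_iff_isUnit_det F).1 hF).ne_zero
  exact le_of_mul_le_mul_left (h3.trans h2.ge) h4

/-- Jacobi's formula. -/
lemma Matrix.hasDerivAt_det {B : ℝ → Matrix n n ℝ} {B' : Matrix n n ℝ} {s : ℝ}
    (hB : ∀ i j, HasDerivAt (fun t => B t i j) (B' i j) s) :
    HasDerivAt (fun t => (B t).det) ((B s).adjugate * B').trace s := by
  let D : ContinuousMultilinearMap ℝ (fun _ : n => n → ℝ) ℝ :=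
    { (Matrix.detRowAlternating : (n → ℝ) [⋀^n]→ₗ[ℝ] ℝ).toMultilinearMap with
      cont := Continuous.matrix_det continuous_id }
  have hrow : ∀ i, HasFDerivAt (fun t => B t i)
      (ContinuousLinearMap.toSpanSingleton ℝ (B' i)) s := fun i =>
    (hasDerivAt_pi.2 (hB i)).hasFDerivAt
  have h := (HasFDerivAt.multilinear_comp (f := D) hrow).hasDerivAt
  refine h.congr_deriv ?_
  have hi : ∀ i, D (Function.update (fun j => B s j) i (B' i)) = ((B s).updateRow i (B' i)).det :=
    fun i => rfl
  simp only [_root_.sum_apply, ContinuousLinearMap.comp_apply,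
    ContinuousLinearMap.toSpanSingleton_apply, one_smul,
    ContinuousMultilinearMap.toContinuousLinearMap_apply, hi]
  rw [Matrix.trace_mul_comm, Matrix.trace]
  refine Finset.sum_congr rfl fun i _ => ?_
  rw [← Matrix.cramer_transpose_apply, Matrix.cramer_eq_adjugate_mulVec,
    ← Matrix.adjugate_transpose]
  simp [Matrix.mulVec, dotProduct, Matrix.mul_apply, mul_comm]

/-- First and second derivative of `log det` along a curve through the identity. -/
lemma Matrix.exists_hasDerivAt_log_det {B B' : ℝ → Matrix n n ℝ} {B'' : Matrix n n ℝ}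
    (h0 : B 0 = 1)
    (hB : ∀ᶠ s in 𝓝 (0 : ℝ), ∀ i j, HasDerivAt (fun t => B t i j) (B' s i j) s)
    (hB' : ∀ i j, HasDerivAt (fun t => B' t i j) (B'' i j) 0) :
    ∃ φ : ℝ → ℝ, (∀ᶠ s in 𝓝 (0 : ℝ), HasDerivAt (fun t => Real.log (B t).det) (φ s) s) ∧
      φ 0 = (B' 0).trace ∧ HasDerivAt φ (B''.trace - (B' 0 * B' 0).trace) 0 := by
  have hB0 := hB.self_of_nhds
  have hdet := Matrix.hasDerivAt_det hB0
  simp only [h0, Matrix.adjugate_one, one_mul] at hdet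
  have hpos : ∀ᶠ s in 𝓝 (0 : ℝ), (B s).det ≠ 0 :=
    hdet.continuousAt.eventually_ne (by simp [h0])
  have hadj : ∀ i j, HasDerivAt (fun t => (B t).adjugate i j)
      (((B' 0).trace • (1 : Matrix n n ℝ) - B' 0) i j) 0 := by
    have hex : ∀ i j, ∃ N, HasDerivAt (fun t => (B t).adjugate i j) N 0 := fun i j => by
      simp only [Matrix.adjugate_apply]
      refine ⟨_, Matrix.hasDerivAt_det
        (B' := (B' 0).updateRow j 0) fun k l => ?_⟩
      by_cases hk : k = j
      · subst hk
        simpa using hasDerivAt_const (0 : ℝ) ((Pi.single i 1 : n → ℝ) l)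
      · simpa [Matrix.updateRow_apply, hk] using hB0 k l
    choose N hN using hex
    intro i j
    have h1 : HasDerivAt (fun t => (B t * (B t).adjugate) i j)
        (∑ k, (B' 0 i k * (B 0).adjugate k j + B 0 i k * N k j)) 0 := by
      simp only [Matrix.mul_apply]
      exact HasDerivAt.fun_sum fun k _ => (hB0 i k).mul (hN k j)
    have h2 : HasDerivAt (fun t => (B t * (B t).adjugate) i j)
        ((B' 0).trace * (1 : Matrix n n ℝ) i j) 0 := by
      simp only [Matrix.mul_adjugate, Matrix.smul_apply, smul_eq_mul]
      exact hdet.mul_const _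
    have h3 := h1.unique h2
    rw [h0, Matrix.adjugate_one] at h3
    simp only [Finset.sum_add_distrib, ← Matrix.mul_apply, mul_one] at h3
    have h4 : ∑ k, (1 : Matrix n n ℝ) i k * N k j = N i j := by
      simp [Matrix.one_apply]
    rw [h4] at h3
    refine (hN i j).congr_deriv ?_
    simp only [Matrix.sub_apply, Matrix.smul_apply, smul_eq_mul]
    linarith
  refine ⟨fun s => ((B s).adjugate * B' s).trace / (B s).det, ?_, by simp [h0], ?_⟩
  · filter_upwards [hB, hpos] with s hs hp
    exact (Matrix.hasDerivAt_det hs).log hp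
  · have h1 : HasDerivAt (fun s => ((B s).adjugate * B' s).trace)
        (∑ i, ∑ k, (((B' 0).trace • (1 : Matrix n n ℝ) - B' 0) i k * B' 0 k i
          + (B 0).adjugate i k * B'' k i)) 0 := by
      simp only [Matrix.trace, Matrix.diag_apply, Matrix.mul_apply]
      exact HasDerivAt.fun_sum fun i _ => HasDerivAt.fun_sum fun k _ => (hadj i k).mul (hB' k i)
    have h2 := h1.div hdet (by simp [h0])
    refine h2.congr_deriv ?_
    simp only [Finset.sum_add_distrib, ← Matrix.mul_apply, h0, Matrix.adjugate_one, one_mul,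
      Matrix.det_one]
    have h5 : ∀ M : Matrix n n ℝ, ∑ i, M i i = M.trace := fun M => rfl
    rw [h5, h5, sub_mul, Matrix.trace_sub, smul_mul_assoc, one_mul, Matrix.trace_smul, smul_eq_mul]
    ring

end Matrices

section DirectionalDerivatives

open scoped Topology ContDiff

variable {E : Type*} [NormedAddCommGroup E] [NormedSpace ℝ E]

/-- The derivative of `f` in the direction `v`. -/
def dirDeriv (v : E) (f : E → ℝ) : E → ℝ := fun x => fderiv ℝ f x v

lemma ContDiffOn.dirDeriv {S : Set E} (hS : IsOpen S) {f : E → ℝ} (hf : ContDiffOn ℝ ∞ f S)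
    (v : E) : ContDiffOn ℝ ∞ (dirDeriv v f) S :=
  (hf.fderiv_of_isOpen hS (by simp)).clm_apply contDiffOn_const

lemma ContDiffOn.differentiableAt_of_isOpen {S : Set E} (hS : IsOpen S) {f : E → ℝ}
    (hf : ContDiffOn ℝ ∞ f S) {x : E} (hx : x ∈ S) : DifferentiableAt ℝ f x :=
  (hf.contDiffAt (hS.mem_nhds hx)).differentiableAt (by simp)

lemma ContDiffOn.hasDerivAt_line {S : Set E} (hS : IsOpen S) {f : E → ℝ}
    (hf : ContDiffOn ℝ ∞ f S) (x v : E) {s : ℝ} (hx : x + s • v ∈ S) :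
    HasDerivAt (fun t : ℝ => f (x + t • v)) (_root_.dirDeriv v f (x + s • v)) s := by
  have h1 : HasDerivAt (fun t : ℝ => x + t • v) v s := by
    simpa using ((hasDerivAt_id s).smul_const v).const_add x
  exact (hf.differentiableAt_of_isOpen hS hx).hasFDerivAt.comp_hasDerivAt s h1

lemma dirDeriv_congr {S : Set E} (hS : IsOpen S) {f h : E → ℝ} (hfh : Set.EqOn f h S) (v : E) :
    Set.EqOn (dirDeriv v f) (dirDeriv v h) S := fun x hx => by
  have : f =ᶠ[𝓝 x] h := Filter.eventuallyEq_of_mem (hS.mem_nhds hx) hfh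
  simp only [dirDeriv, this.fderiv_eq]

lemma dirDeriv_comm {S : Set E} (hS : IsOpen S) {f : E → ℝ} (hf : ContDiffOn ℝ ∞ f S) (v w : E) :
    Set.EqOn (dirDeriv v (dirDeriv w f)) (dirDeriv w (dirDeriv v f)) S := fun x hx => by
  have hd : DifferentiableAt ℝ (fderiv ℝ f) x :=
    ((hf.fderiv_of_isOpen hS (m := ∞) (by simp)).contDiffAt (hS.mem_nhds hx)).differentiableAt
      (by simp)
  have h := (hf.contDiffAt (hS.mem_nhds hx)).isSymmSndFDerivAt
    (by simpa using WithTop.coe_le_coe.2 (le_top : (2 : ℕ∞) ≤ ⊤)) v w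
  have h1 : ∀ a b : E, dirDeriv a (dirDeriv b f) x = fderiv ℝ (fderiv ℝ f) x a b := fun a b => by
    unfold dirDeriv
    rw [fderiv_clm_apply hd (differentiableAt_const b)]
    simp
  rw [h1, h1, h]

lemma dirDeriv_sum {ι : Type*} (s : Finset ι) (a : ι → ℝ) (w : ι → E) (f : E → ℝ) (x : E) :
    dirDeriv (∑ j ∈ s, a j • w j) f x = ∑ j ∈ s, a j * dirDeriv (w j) f x := by
  simp [dirDeriv, map_sum]

lemma dirDeriv_dirDeriv_sum {S : Set E} (hS : IsOpen S) {f : E → ℝ} (hf : ContDiffOn ℝ ∞ f S)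
    {x : E} (hx : x ∈ S) {ι : Type*} (s : Finset ι) (a : ι → ℝ) (w : ι → E) (v : E) :
    dirDeriv v (dirDeriv (∑ j ∈ s, a j • w j) f) x
      = ∑ j ∈ s, a j * dirDeriv v (dirDeriv (w j) f) x := by
  have h : dirDeriv (∑ j ∈ s, a j • w j) f = fun y => ∑ j ∈ s, a j * dirDeriv (w j) f y :=
    funext fun y => dirDeriv_sum s a w f y
  have hd : ∀ j ∈ s, DifferentiableAt ℝ (fun y => a j * dirDeriv (w j) f y) x := fun j _ =>
    ((hf.dirDeriv hS (w j)).differentiableAt_of_isOpen hS hx).const_mul _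
  rw [h]
  change fderiv ℝ (fun y => ∑ j ∈ s, a j * dirDeriv (w j) f y) x v = _
  rw [fderiv_fun_sum hd, _root_.sum_apply]
  refine Finset.sum_congr rfl fun j _ => ?_
  rw [fderiv_const_mul ((hf.dirDeriv hS (w j)).differentiableAt_of_isOpen hS hx)]
  rfl

/-- Second derivative test: necessary condition at a local maximum. -/
lemma IsLocalMax.second_deriv_nonpos {w w' : ℝ → ℝ} {c : ℝ} (hmax : IsLocalMax w 0)
    (hw : ∀ᶠ s in 𝓝 (0 : ℝ), HasDerivAt w (w' s) s) (hw' : HasDerivAt w' c 0) :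
    w' 0 = 0 ∧ c ≤ 0 := by
  have h0 : w' 0 = 0 := hmax.hasDerivAt_eq_zero hw.self_of_nhds
  refine ⟨h0, ?_⟩
  by_contra! hc
  have hderiv : deriv w =ᶠ[𝓝 0] w' := hw.mono fun s hs => hs.deriv
  have h2 : deriv (deriv w) 0 = c := by rw [hderiv.deriv_eq, hw'.deriv]
  have hmin := isLocalMin_of_deriv_deriv_pos (by rw [h2]; exact hc)
    (by rw [hw.self_of_nhds.deriv, h0]) hw.self_of_nhds.continuousAt
  have hconst : w =ᶠ[𝓝 0] fun _ => w 0 := by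
    filter_upwards [hmax, hmin] with s h1 h3 using le_antisymm h1 h3
  have h4 : deriv w =ᶠ[𝓝 0] fun _ => 0 := by
    have := hconst.deriv
    simpa using this
  have h5 : deriv (deriv w) 0 = 0 := by rw [h4.deriv_eq]; simp
  linarith

end DirectionalDerivatives

section Simplex

open scoped Topology ContDiff

variable {d : ℕ}

lemma hess_apply (u : (Fin d → ℝ) → ℝ) (x : Fin d → ℝ) (i j : Fin d) :
    hess d u x i j = dirDeriv (Pi.single i 1) (dirDeriv (Pi.single j 1) u) x := rfl

lemma dirDeriv_dirDeriv_eq_hess {S : Set (Fin d → ℝ)} (hS : IsOpen S) {u : (Fin d → ℝ) → ℝ}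
    (hu : ContDiffOn ℝ ∞ u S) {x : Fin d → ℝ} (hx : x ∈ S) (v w : Fin d → ℝ) :
    dirDeriv v (dirDeriv w u) x = v ⬝ᵥ (hess d u x).mulVec w := by
  have hv : ∀ v : Fin d → ℝ, v = ∑ j ∈ Finset.univ, v j • (Pi.single j 1 : Fin d → ℝ) := fun v => by
    ext k
    simp [Finset.sum_apply, Pi.single_apply]
  conv_lhs => rw [hv v, hv w, dirDeriv_sum]
  simp only [dirDeriv_dirDeriv_sum hS hu hx, dotProduct, Matrix.mulVec, hess_apply]
  exact Finset.sum_congr rfl fun i _ => by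
    congr 1
    exact Finset.sum_congr rfl fun j _ => mul_comm _ _

lemma hess_apply_symm {S : Set (Fin d → ℝ)} (hS : IsOpen S) {u : (Fin d → ℝ) → ℝ}
    (hu : ContDiffOn ℝ ∞ u S) {x : Fin d → ℝ} (hx : x ∈ S) : (hess d u x).IsHermitian := by
  ext i j
  simpa [hess_apply] using dirDeriv_comm hS hu _ _ hx

lemma isOpen_simplexΔ : IsOpen (simplexΔ d) := by
  have h1 : IsOpen {x : Fin d → ℝ | ∀ i, 0 < x i} := by
    simp only [Set.ofPred_forall]
    exact isOpen_iInter_of_finite fun i => isOpen_lt continuous_const (continuous_apply i)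
  exact h1.inter (isOpen_lt (f := fun x : Fin d → ℝ => ∑ i, x i) (by fun_prop) continuous_const)

lemma simplexΔ.lt_one {x : Fin d → ℝ} (hx : x ∈ simplexΔ d) (i : Fin d) : x i < 1 :=
  (Finset.single_le_sum (f := x) (fun j _ => (hx.1 j).le) (Finset.mem_univ i)).trans_lt hx.2

/-- Solutions of the Monge-Ampère equation on the simplex with infinite boundary values. -/
structure IsBarrierSolution (g : (Fin d → ℝ) → ℝ) : Prop where
  contDiffOn : ContDiffOn ℝ ∞ g (simplexΔ d)
  posDef : ∀ x ∈ simplexΔ d, (hess d g x).PosDef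
  eq_log_det : ∀ x ∈ simplexΔ d, g x = Real.log (((2 : ℝ)⁻¹ • hess d g x).det)
  tendsto_atTop : ∀ x ∈ frontier (simplexΔ d), Tendsto g (𝓝[simplexΔ d] x) atTop

namespace IsBarrierSolution

variable {g : (Fin d → ℝ) → ℝ}

lemma isCompact_sublevel (hg : IsBarrierSolution g) (R : ℝ) :
    IsCompact {x | x ∈ simplexΔ d ∧ g x ≤ R} := by
  refine (isCompact_Icc (a := (0 : Fin d → ℝ)) (b := 1)).of_isClosed_subset ?_ ?_
  · refine isClosed_of_closure_subset fun x hx => ?_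
    have hxc : x ∈ closure (simplexΔ d) := closure_mono (fun y hy => hy.1) hx
    have hfr : ∃ᶠ y in 𝓝[simplexΔ d] x, g y ≤ R := by
      rw [mem_closure_iff_frequently] at hx
      rw [frequently_nhdsWithin_iff]
      exact hx.mono fun y hy => ⟨hy.2, hy.1⟩
    by_cases hxS : x ∈ simplexΔ d
    · refine ⟨hxS, ?_⟩
      by_contra! h
      have hc := (hg.contDiffOn.continuousOn x hxS).eventually (lt_mem_nhds h)
      obtain ⟨y, hy1, hy2⟩ := (hfr.and_eventually hc).exists
      exact absurd hy1 (not_le.2 hy2)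
    · have hxf : x ∈ frontier (simplexΔ d) := by
        rw [isOpen_simplexΔ.frontier_eq]
        exact ⟨hxc, hxS⟩
      obtain ⟨y, hy1, hy2⟩ :=
        (hfr.and_eventually ((hg.tendsto_atTop x hxf).eventually_gt_atTop R)).exists
      exact absurd hy1 (not_le.2 hy2)
  · exact fun x hx => ⟨fun i => (hx.1.1 i).le, fun i => (simplexΔ.lt_one hx.1 i).le⟩

/-- Comparison principle with bounded subsolutions. -/
lemma comparison (hg : IsBarrierSolution g) {u : (Fin d → ℝ) → ℝ}
    (hu : ContDiffOn ℝ ∞ u (simplexΔ d)) (hpos : ∀ x ∈ simplexΔ d, (hess d u x).PosDef)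
    (hsub : ∀ x ∈ simplexΔ d, u x ≤ Real.log (((2 : ℝ)⁻¹ • hess d u x).det))
    {R : ℝ} (hR : ∀ x ∈ simplexΔ d, u x ≤ R) {x : Fin d → ℝ} (hx : x ∈ simplexΔ d) :
    u x ≤ g x := by
  have hS := isOpen_simplexΔ (d := d)
  have hK := hg.isCompact_sublevel (g x - u x + R)
  have hcont : ContinuousOn (fun y => g y - u y)
      {y | y ∈ simplexΔ d ∧ g y ≤ g x - u x + R} :=
    (hg.contDiffOn.continuousOn.sub hu.continuousOn).mono fun y hy => hy.1
  obtain ⟨z, hz, hmin⟩ := hK.exists_isMinOn ⟨x, hx, by linarith [hR x hx]⟩ hcont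
  have hzx : g z - u z ≤ g x - u x := hmin ⟨hx, by linarith [hR x hx]⟩
  have hglob : ∀ y ∈ simplexΔ d, g z - u z ≤ g y - u y := fun y hy => by
    by_cases hyR : g y ≤ g x - u x + R
    · exact hmin ⟨hy, hyR⟩
    · linarith [hR y hy, not_le.1 hyR]
  have hgu : ContDiffOn ℝ ∞ (fun y => u y - g y) (simplexΔ d) := hu.sub hg.contDiffOn
  have hdiff : (hess d g z - hess d u z).PosSemidef := by
    refine Matrix.PosSemidef.of_dotProduct_mulVec_nonneg
      ((hess_apply_symm hS hg.contDiffOn hz.1).sub (hess_apply_symm hS hu hz.1)) fun v => ?_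
    have hline : ∀ᶠ s in 𝓝 (0 : ℝ), z + s • v ∈ simplexΔ d :=
      (by fun_prop : Continuous fun s : ℝ => z + s • v).continuousAt.eventually
        (hS.mem_nhds (by simpa using hz.1))
    have hmax : IsLocalMax (fun s : ℝ => u (z + s • v) - g (z + s • v)) 0 := by
      filter_upwards [hline] with s hs
      have := hglob _ hs
      simp only [zero_smul, add_zero]
      linarith
    have hz0 : z + (0 : ℝ) • v ∈ simplexΔ d := by simpa using hz.1
    have h := (hmax.second_deriv_nonpos
      (hline.mono fun s hs => (hu.hasDerivAt_line hS z v hs).sub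
        (hg.contDiffOn.hasDerivAt_line hS z v hs))
      (((hu.dirDeriv hS v).hasDerivAt_line hS z v hz0).sub
        ((hg.contDiffOn.dirDeriv hS v).hasDerivAt_line hS z v hz0))).2
    simp only [zero_smul, add_zero, dirDeriv_dirDeriv_eq_hess hS hu hz.1,
      dirDeriv_dirDeriv_eq_hess hS hg.contDiffOn hz.1] at h
    simp only [star_trivial, Matrix.sub_mulVec, dotProduct_sub]
    linarith
  have hdet := (hg.posDef z hz.1).det_le_det (hpos z hz.1).posSemidef hdiff
  have hlog : Real.log (((2 : ℝ)⁻¹ • hess d u z).det) ≤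
      Real.log (((2 : ℝ)⁻¹ • hess d g z).det) := by
    rw [Matrix.det_smul, Matrix.det_smul]
    have := (hpos z hz.1).det_pos
    exact Real.log_le_log (by positivity) (by gcongr)
  linarith [hsub z hz.1, hg.eq_log_det z hz.1]

lemma _root_.hess_add_const (u : (Fin d → ℝ) → ℝ) (c : ℝ) (x : Fin d → ℝ) :
    hess d (fun y => u y + c) x = hess d u x := by
  ext i j
  simp [hess]

lemma _root_.dirDeriv_comp_affine {f : (Fin d → ℝ) → ℝ} (hf : ContDiffOn ℝ ∞ f (simplexΔ d))
    {M : Matrix (Fin d) (Fin d) ℝ} {c : Fin d → ℝ}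
    (hT : ∀ x ∈ simplexΔ d, M.mulVec x + c ∈ simplexΔ d) (v : Fin d → ℝ) :
    Set.EqOn (dirDeriv v fun x => f (M.mulVec x + c))
      (fun x => dirDeriv (M.mulVec v) f (M.mulVec x + c)) (simplexΔ d) := fun x hx => by
  have h1 : HasFDerivAt (fun x : Fin d → ℝ => M.mulVec x + c)
      (M.mulVecLin.toContinuousLinearMap) x :=
    (M.mulVecLin.toContinuousLinearMap.hasFDerivAt (x := x)).add_const c
  have h2 := (hf.differentiableAt_of_isOpen isOpen_simplexΔ (hT x hx)).hasFDerivAt.comp x h1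
  unfold dirDeriv
  change fderiv ℝ (f ∘ fun x => M.mulVec x + c) x v = _
  rw [h2.fderiv]
  rfl

lemma _root_.ContDiffOn.comp_affine {f : (Fin d → ℝ) → ℝ} (hf : ContDiffOn ℝ ∞ f (simplexΔ d))
    {M : Matrix (Fin d) (Fin d) ℝ} {c : Fin d → ℝ}
    (hT : ∀ x ∈ simplexΔ d, M.mulVec x + c ∈ simplexΔ d) :
    ContDiffOn ℝ ∞ (fun x => f (M.mulVec x + c)) (simplexΔ d) := by
  refine hf.comp (t := simplexΔ d) (ContDiff.contDiffOn ?_) hT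
  exact (M.mulVecLin.toContinuousLinearMap.contDiff).add contDiff_const

lemma _root_.dirDeriv_dirDeriv_comp_affine {f : (Fin d → ℝ) → ℝ}
    (hf : ContDiffOn ℝ ∞ f (simplexΔ d)) {M : Matrix (Fin d) (Fin d) ℝ} {c : Fin d → ℝ}
    (hT : ∀ x ∈ simplexΔ d, M.mulVec x + c ∈ simplexΔ d) (v w : Fin d → ℝ) {x : Fin d → ℝ}
    (hx : x ∈ simplexΔ d) :
    dirDeriv v (dirDeriv w fun x => f (M.mulVec x + c)) x
      = dirDeriv (M.mulVec v) (dirDeriv (M.mulVec w) f) (M.mulVec x + c) := by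
  rw [dirDeriv_congr isOpen_simplexΔ (dirDeriv_comp_affine hf hT w) v hx]
  exact dirDeriv_comp_affine (hf.dirDeriv isOpen_simplexΔ (M.mulVec w)) hT v hx

lemma _root_.hess_comp_affine {f : (Fin d → ℝ) → ℝ} (hf : ContDiffOn ℝ ∞ f (simplexΔ d))
    {M : Matrix (Fin d) (Fin d) ℝ} {c : Fin d → ℝ}
    (hT : ∀ x ∈ simplexΔ d, M.mulVec x + c ∈ simplexΔ d) {x : Fin d → ℝ}
    (hx : x ∈ simplexΔ d) :
    hess d (fun x => f (M.mulVec x + c)) x = Mᵀ * hess d f (M.mulVec x + c) * M := by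
  ext i j
  rw [hess_apply, dirDeriv_dirDeriv_comp_affine hf hT _ _ hx,
    dirDeriv_dirDeriv_eq_hess isOpen_simplexΔ hf (hT x hx)]
  have hcol : ∀ k, M.mulVec (Pi.single k 1) = fun l => M l k := fun k => by
    ext l
    simp
  rw [hcol, hcol]
  simp only [Matrix.mul_apply, dotProduct, Matrix.mulVec, Matrix.transpose_apply,
    Finset.mul_sum, Finset.sum_mul]
  rw [Finset.sum_comm]
  exact Finset.sum_congr rfl fun k _ => Finset.sum_congr rfl fun l _ => by ring

lemma posDef_hess_comp_affine (hg : IsBarrierSolution g) {M : Matrix (Fin d) (Fin d) ℝ}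
    {c : Fin d → ℝ} (hM : M.det ≠ 0) (hT : ∀ x ∈ simplexΔ d, M.mulVec x + c ∈ simplexΔ d)
    {x : Fin d → ℝ} (hx : x ∈ simplexΔ d) :
    (hess d (fun x => g (M.mulVec x + c)) x).PosDef := by
  rw [hess_comp_affine hg.contDiffOn hT hx]
  have hinj : Function.Injective M.mulVec := Matrix.mulVec_injective_of_isUnit
    ((Matrix.isUnit_iff_isUnit_det M).2 (isUnit_iff_ne_zero.2 hM))
  simpa [Matrix.conjTranspose_eq_transpose_of_trivial] using
    (hg.posDef _ (hT x hx)).conjTranspose_mul_mul_same hinj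

lemma log_det_hess_comp_affine (hg : IsBarrierSolution g) {M : Matrix (Fin d) (Fin d) ℝ}
    {c : Fin d → ℝ} (hM : M.det ≠ 0) (hT : ∀ x ∈ simplexΔ d, M.mulVec x + c ∈ simplexΔ d)
    {x : Fin d → ℝ} (hx : x ∈ simplexΔ d) :
    Real.log (((2 : ℝ)⁻¹ • hess d (fun x => g (M.mulVec x + c)) x).det)
      = g (M.mulVec x + c) + 2 * Real.log |M.det| := by
  have hpos := (hg.posDef _ (hT x hx)).det_pos
  rw [hess_comp_affine hg.contDiffOn hT hx, hg.eq_log_det _ (hT x hx), Real.log_abs]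
  simp only [Matrix.det_smul, Matrix.det_mul, Matrix.det_transpose]
  rw [show (2⁻¹ : ℝ) ^ Fintype.card (Fin d) *
      (M.det * (hess d g (M.mulVec x + c)).det * M.det) = (2⁻¹ : ℝ) ^ Fintype.card (Fin d) *
      (hess d g (M.mulVec x + c)).det * M.det ^ 2 by ring,
    Real.log_mul (by positivity) (by positivity), Real.log_pow]
  norm_num

/-- Monotonicity under affine contractions of the simplex. -/
lemma comp_affine_le (hg : IsBarrierSolution g) {M : Matrix (Fin d) (Fin d) ℝ}
    {c : Fin d → ℝ} (hM : M.det ≠ 0) (hT : ∀ x ∈ simplexΔ d, M.mulVec x + c ∈ simplexΔ d)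
    {R : ℝ} (hR : ∀ x ∈ simplexΔ d, g (M.mulVec x + c) ≤ R) {x : Fin d → ℝ}
    (hx : x ∈ simplexΔ d) : g (M.mulVec x + c) + 2 * Real.log |M.det| ≤ g x := by
  refine hg.comparison (u := fun x => g (M.mulVec x + c) + 2 * Real.log |M.det|)
    ((hg.contDiffOn.comp_affine hT).add contDiffOn_const) (fun y hy => ?_) (fun y hy => ?_)
    (R := R + 2 * Real.log |M.det|) (fun y hy => by linarith [hR y hy]) hx
  · rw [hess_add_const]
    exact hg.posDef_hess_comp_affine hM hT hy
  · rw [hess_add_const, hg.log_det_hess_comp_affine hM hT hy]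

/-- Closed subsets of the simplex at a fixed distance from the boundary. -/
lemma exists_upper_bound (hg : IsBarrierSolution g) {c : ℝ} (hc : 0 < c) :
    ∃ R, ∀ y : Fin d → ℝ, (∀ i, c ≤ y i) → c ≤ 1 - ∑ i, y i → g y ≤ R := by
  have hsub : {y : Fin d → ℝ | (∀ i, c ≤ y i) ∧ c ≤ 1 - ∑ i, y i} ⊆ simplexΔ d := fun y hy =>
    ⟨fun i => hc.trans_le (hy.1 i), by linarith [hy.2]⟩
  have hK : IsCompact {y : Fin d → ℝ | (∀ i, c ≤ y i) ∧ c ≤ 1 - ∑ i, y i} := by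
    refine (isCompact_Icc (a := (0 : Fin d → ℝ)) (b := 1)).of_isClosed_subset ?_
      fun y hy => ⟨fun i => ((hsub hy).1 i).le, fun i => (simplexΔ.lt_one (hsub hy) i).le⟩
    have h1 : IsClosed {y : Fin d → ℝ | ∀ i, c ≤ y i} := by
      simp only [Set.ofPred_forall]
      exact isClosed_iInter fun i => isClosed_le continuous_const (continuous_apply i)
    exact h1.inter (isClosed_le (g := fun y : Fin d → ℝ => 1 - ∑ i, y i)
      continuous_const (by fun_prop))
  obtain ⟨R, hR⟩ := hK.bddAbove_image (hg.contDiffOn.continuousOn.mono hsub)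
  exact ⟨R, fun y h1 h2 => hR ⟨y, ⟨h1, h2⟩, rfl⟩⟩

/-- Monotonicity under coordinatewise contractions towards the origin. -/
lemma scale_le (hg : IsBarrierSolution g) {θ : Fin d → ℝ} (hθ0 : ∀ i, 0 < θ i)
    (hθ1 : ∀ i, θ i ≤ 1) {x : Fin d → ℝ} (hx : x ∈ simplexΔ d) :
    g (fun i => θ i * x i) + 2 * ∑ i, Real.log (θ i) ≤ g x := by
  have hθx : (fun i => θ i * x i) ∈ simplexΔ d :=
    ⟨fun i => mul_pos (hθ0 i) (hx.1 i), (Finset.sum_le_sum fun i _ =>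
      mul_le_of_le_one_left (hx.1 i).le (hθ1 i)).trans_lt hx.2⟩
  have hd : (0 : ℝ) < (d : ℝ) + 1 := by positivity
  have key : ∀ ε ∈ Set.Ioo (0 : ℝ) 1,
      g (fun i => (1 - ε) * (θ i * x i) + ε * ((d : ℝ) + 1)⁻¹) +
        2 * ∑ i, Real.log ((1 - ε) * θ i) ≤ g x := fun ε hε => by
    have h1 : 0 < 1 - ε := by linarith [hε.2]
    set M : Matrix (Fin d) (Fin d) ℝ := Matrix.diagonal fun i => (1 - ε) * θ i with hM
    set c : Fin d → ℝ := fun _ => ε * ((d : ℝ) + 1)⁻¹ with hc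
    have hTy : ∀ y, M.mulVec y + c = fun i => (1 - ε) * (θ i * y i) + ε * ((d : ℝ) + 1)⁻¹ :=
      fun y => by
        ext i
        simp [hM, hc, Matrix.mulVec_diagonal, mul_assoc]
    have hcpos : 0 < ε * ((d : ℝ) + 1)⁻¹ := mul_pos hε.1 (inv_pos.2 hd)
    have hlow : ∀ y ∈ simplexΔ d, ∀ i, ε * ((d : ℝ) + 1)⁻¹ ≤ (M.mulVec y + c) i :=
      fun y hy i => by
        rw [hTy]
        have : 0 < (1 - ε) * (θ i * y i) := mul_pos h1 (mul_pos (hθ0 i) (hy.1 i))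
        linarith
    have hup : ∀ y ∈ simplexΔ d, ε * ((d : ℝ) + 1)⁻¹ ≤ 1 - ∑ i, (M.mulVec y + c) i :=
      fun y hy => by
        simp only [hTy, Finset.sum_add_distrib, ← Finset.mul_sum, Finset.sum_const,
          Finset.card_univ, Fintype.card_fin, nsmul_eq_mul]
        have h2 : ∑ i, θ i * y i ≤ 1 := (Finset.sum_le_sum fun i _ =>
          mul_le_of_le_one_left (hy.1 i).le (hθ1 i)).trans hy.2.le
        have h3 : (1 - ε) * ∑ i, θ i * y i ≤ (1 - ε) * 1 := by gcongr
        have h4 : ε * ((d : ℝ) + 1)⁻¹ + (d : ℝ) * (ε * ((d : ℝ) + 1)⁻¹) = ε := by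
          field_simp
          ring
        linarith
    have hT : ∀ y ∈ simplexΔ d, M.mulVec y + c ∈ simplexΔ d := fun y hy =>
      ⟨fun i => hcpos.trans_le (hlow y hy i), by linarith [hup y hy]⟩
    obtain ⟨R, hR⟩ := hg.exists_upper_bound hcpos
    have hdet : M.det = ∏ i, (1 - ε) * θ i := Matrix.det_diagonal
    have hdpos : 0 < M.det := by
      rw [hdet]
      exact Finset.prod_pos fun i _ => mul_pos h1 (hθ0 i)
    have h := hg.comp_affine_le hdpos.ne' hT (fun y hy => hR _ (hlow y hy) (hup y hy)) hx
    rwa [hTy, abs_of_pos hdpos, hdet,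
      Real.log_prod fun i _ => (mul_pos h1 (hθ0 i)).ne'] at h
  have hcont : ContinuousAt (fun ε : ℝ =>
      g (fun i => (1 - ε) * (θ i * x i) + ε * ((d : ℝ) + 1)⁻¹) +
        2 * ∑ i, Real.log ((1 - ε) * θ i)) 0 := by
    refine ContinuousAt.add (ContinuousAt.comp (g := g) ?_ (by fun_prop)) ?_
    · simpa using hg.contDiffOn.continuousOn.continuousAt (isOpen_simplexΔ.mem_nhds hθx)
    · refine continuousAt_const.mul (tendsto_finsetSum _ fun i _ => ?_)
      exact ContinuousAt.log (by fun_prop) (by simpa using (hθ0 i).ne')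
  have hlim := hcont.tendsto.mono_left (nhdsWithin_le_nhds (s := Set.Ioi 0))
  simp only [sub_zero, one_mul, zero_mul, add_zero] at hlim
  refine le_of_tendsto hlim ?_
  filter_upwards [Ioo_mem_nhdsGT (zero_lt_one' ℝ)] with ε hε using key ε hε

/-- Comparison with the explicit solution on the positive orthant. -/
lemma lower_bound (hg : IsBarrierSolution g) {x : Fin d → ℝ} (hx : x ∈ simplexΔ d) :
    -2 * ∑ i, Real.log (x i) ≤ g x := by
  have key : ∀ ε ∈ Set.Ioo (0 : ℝ) 1, -2 * ∑ i, Real.log (x i + ε) ≤ g x := fun ε hε => by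
    have hpos : ∀ y ∈ simplexΔ d, ∀ i, 0 < y i + ε := fun y hy i => add_pos (hy.1 i) hε.1
    set u : (Fin d → ℝ) → ℝ := fun y => -2 * ∑ i, Real.log (y i + ε) with hu
    have hder : ∀ j, Set.EqOn (dirDeriv (Pi.single j 1) u) (fun y => -2 * (y j + ε)⁻¹)
        (simplexΔ d) := fun j y hy => by
      have h1 : ∀ i, HasFDerivAt (fun y : Fin d → ℝ => Real.log (y i + ε))
          ((y i + ε)⁻¹ • ContinuousLinearMap.proj (R := ℝ) (φ := fun _ : Fin d => ℝ) i) y :=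
        fun i => ((hasFDerivAt_apply i y).add_const ε).log (hpos y hy i).ne'
      have h2 := (HasFDerivAt.fun_sum fun i (_ : i ∈ Finset.univ) => h1 i).const_mul (-2)
      unfold dirDeriv
      rw [h2.fderiv]
      simp [_root_.sum_apply, Pi.single_apply]
    have hhess : ∀ y ∈ simplexΔ d, hess d u y = Matrix.diagonal fun i => 2 * ((y i + ε) ^ 2)⁻¹ :=
      fun y hy => by
        ext i j
        rw [hess_apply, dirDeriv_congr isOpen_simplexΔ (hder j) _ hy]
        have h1 : HasFDerivAt (fun y : Fin d → ℝ => -2 * (y j + ε)⁻¹)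
            ((-2 : ℝ) • (-((y j + ε) ^ 2)⁻¹ •
              ContinuousLinearMap.proj (R := ℝ) (φ := fun _ : Fin d => ℝ) j)) y :=
          ((hasDerivAt_inv (hpos y hy j).ne').comp_hasFDerivAt y
            ((hasFDerivAt_apply j y).add_const ε)).const_mul (-2)
        unfold dirDeriv
        rw [h1.fderiv]
        by_cases hij : i = j
        · subst hij
          simp
        · simp [hij, Ne.symm hij]
    refine hg.comparison (u := u) ?_ (fun y hy => ?_) (fun y hy => ?_)
      (R := -2 * ∑ _i : Fin d, Real.log ε) (fun y hy => ?_) hx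
    · refine contDiffOn_const.mul (ContDiffOn.sum fun i _ => ?_)
      exact ContDiffOn.log (ContDiff.contDiffOn (by fun_prop)) fun y hy => (hpos y hy i).ne'
    · rw [hhess y hy, Matrix.posDef_diagonal_iff]
      intro i
      have := hpos y hy i
      positivity
    · rw [hhess y hy, ← Matrix.diagonal_smul, Matrix.det_diagonal, Real.log_prod fun i _ => ?_]
      · simp only [hu, Finset.mul_sum]
        refine Finset.sum_le_sum fun i _ => ?_
        simp [Real.log_inv, Real.log_pow]
      · have := hpos y hy i
        simp only [Pi.smul_apply, smul_eq_mul]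
        positivity
    · have : ∑ _i : Fin d, Real.log ε ≤ ∑ i, Real.log (y i + ε) :=
        Finset.sum_le_sum fun i _ => Real.log_le_log hε.1 (by linarith [hy.1 i])
      simp only [hu]
      linarith
  have hcont : ContinuousAt (fun ε : ℝ => -2 * ∑ i, Real.log (x i + ε)) 0 := by
    refine continuousAt_const.mul (tendsto_finsetSum _ fun i _ => ?_)
    exact ContinuousAt.log (by fun_prop) (by simpa using (hx.1 i).ne')
  have hlim := hcont.tendsto.mono_left (nhdsWithin_le_nhds (s := Set.Ioi 0))
  simp only [add_zero] at hlim
  refine le_of_tendsto hlim ?_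
  filter_upwards [Ioo_mem_nhdsGT (zero_lt_one' ℝ)] with ε hε using key ε hε

/-- One-sided gradient bound. -/
lemma neg_two_le_mul_dirDeriv (hg : IsBarrierSolution g) {x : Fin d → ℝ} (hx : x ∈ simplexΔ d)
    (i : Fin d) : -2 ≤ x i * dirDeriv (Pi.single i 1) g x := by
  have hline : HasDerivAt (fun a : ℝ => g (x + a • Pi.single i (-(x i))))
      (dirDeriv (Pi.single i (-(x i))) g (x + (0 : ℝ) • Pi.single i (-(x i)))) 0 :=
    hg.contDiffOn.hasDerivAt_line isOpen_simplexΔ x _ (by simpa using hx)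
  have hlog : HasDerivAt (fun a : ℝ => Real.log (1 - a)) (-1 / (1 - 0)) 0 :=
    ((hasDerivAt_id (0 : ℝ)).const_sub 1).log (by simp)
  have h := (hline.add (hlog.const_mul 2)).tendsto_slope_zero_right
  have hle := le_of_tendsto (b := (0 : ℝ)) h ?_
  · have hs : dirDeriv (Pi.single i (-(x i))) g x = -(x i * dirDeriv (Pi.single i 1) g x) := by
      have : (Pi.single i (-(x i)) : Fin d → ℝ) = (-(x i)) • Pi.single i 1 := by
        rw [← Pi.single_smul]
        simp
      simp only [dirDeriv]
      rw [this, map_smul]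
      simp
    rw [zero_smul, add_zero, hs] at hle
    linarith
  · filter_upwards [Ioo_mem_nhdsGT (zero_lt_one' ℝ)] with a ha
    have h1 : 0 < 1 - a := by linarith [ha.2]
    have h2 := hg.scale_le (θ := Function.update 1 i (1 - a)) (fun j => ?_) (fun j => ?_) hx
    · have h3 : (fun j => (Function.update 1 i (1 - a) : Fin d → ℝ) j * x j)
          = x + a • Pi.single i (-(x i)) := by
        ext j
        by_cases hj : j = i
        · subst hj
          simp
          ring
        · simp [hj]
      have h4 : ∑ j, Real.log ((Function.update 1 i (1 - a) : Fin d → ℝ) j)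
          = Real.log (1 - a) := by
        rw [Finset.sum_eq_single i (fun j _ hj => by simp [hj]) (by simp)]
        simp
      rw [h3, h4] at h2
      refine mul_nonpos_of_nonneg_of_nonpos (inv_nonneg.2 ha.1.le) ?_
      simp only [Pi.add_apply, zero_add, zero_smul, add_zero, sub_zero, Real.log_one, mul_zero]
      linarith
    · by_cases hj : j = i
      · subst hj
        simpa using ha.2
      · simp [hj]
    · by_cases hj : j = i
      · subst hj
        simpa using ha.1.le
      · simp [hj]

end IsBarrierSolution

section Swap

/-- Linear part of the affine involution of the simplex exchanging `0` and `eᵢ`. -/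
def vertexSwap (i : Fin d) : Matrix (Fin d) (Fin d) ℝ :=
  (1 : Matrix (Fin d) (Fin d) ℝ).updateRow i fun _ => -1

lemma vertexSwap_mulVec (i : Fin d) (v : Fin d → ℝ) :
    (vertexSwap i).mulVec v = Function.update v i (-∑ j, v j) := by
  ext k
  by_cases hk : k = i
  · subst hk
    simp [vertexSwap, Matrix.mulVec, dotProduct]
  · simp [vertexSwap, Matrix.mulVec, dotProduct, hk, Matrix.one_apply]

lemma vertexSwap_affine (i : Fin d) (x : Fin d → ℝ) :
    (vertexSwap i).mulVec x + Pi.single i 1 = Function.update x i (1 - ∑ j, x j) := by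
  rw [vertexSwap_mulVec]
  ext k
  by_cases hk : k = i
  · subst hk
    simp
    ring
  · simp [hk]

lemma sum_update_eq (i : Fin d) (x : Fin d → ℝ) (c : ℝ) :
    ∑ j, Function.update x i c j = ∑ j, x j - x i + c := by
  rw [Finset.sum_update_of_mem (Finset.mem_univ i), ← Finset.add_sum_erase _ _ (Finset.mem_univ i),
    Finset.sdiff_singleton_eq_erase]
  ring

lemma abs_det_vertexSwap (i : Fin d) : |(vertexSwap i).det| = 1 := by
  have h : vertexSwap i * vertexSwap i = 1 := by
    refine Matrix.ext_of_mulVec_single fun k => ?_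
    rw [← Matrix.mulVec_mulVec, vertexSwap_mulVec, vertexSwap_mulVec, sum_update_eq,
      Matrix.one_mulVec]
    simp
  have h2 := congrArg Matrix.det h
  rw [Matrix.det_mul, Matrix.det_one, ← abs_mul_abs_self] at h2
  nlinarith [abs_nonneg (vertexSwap i).det]

lemma update_mem_simplexΔ {x : Fin d → ℝ} (hx : x ∈ simplexΔ d) (i : Fin d) :
    Function.update x i (1 - ∑ j, x j) ∈ simplexΔ d := by
  refine ⟨fun j => ?_, ?_⟩
  · by_cases hj : j = i
    · subst hj
      simpa using hx.2
    · simpa [hj] using hx.1 j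
  · rw [sum_update_eq]
    linarith [hx.1 i]

lemma vertexSwap_affine_mem (i : Fin d) :
    ∀ x ∈ simplexΔ d, (vertexSwap i).mulVec x + Pi.single i 1 ∈ simplexΔ d := fun x hx => by
  rw [vertexSwap_affine]
  exact update_mem_simplexΔ hx i

lemma update_involutive (i : Fin d) :
    Function.Involutive fun x : Fin d → ℝ => Function.update x i (1 - ∑ j, x j) := fun x => by
  simp only [sum_update_eq, Function.update_idem]
  convert Function.update_eq_self i x using 2
  ring

end Swap

namespace IsBarrierSolution

variable {g : (Fin d → ℝ) → ℝ}

/-- The class of solutions is invariant under exchanging the vertices `0` and `eᵢ`. -/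
lemma comp_swap (hg : IsBarrierSolution g) (i : Fin d) :
    IsBarrierSolution fun x => g ((vertexSwap i).mulVec x + Pi.single i 1) := by
  have hT := vertexSwap_affine_mem i
  have hdet : (vertexSwap i).det ≠ 0 := fun h => by
    simpa [h] using abs_det_vertexSwap i
  refine ⟨hg.contDiffOn.comp_affine hT, fun x hx => hg.posDef_hess_comp_affine hdet hT hx,
    fun x hx => ?_, fun x hx => ?_⟩
  · rw [hg.log_det_hess_comp_affine hdet hT hx, abs_det_vertexSwap]
    simp
  · simp only [vertexSwap_affine]
    set T : (Fin d → ℝ) → (Fin d → ℝ) := fun x => Function.update x i (1 - ∑ j, x j)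
    have hTc : Continuous T := continuous_id.update i (by fun_prop)
    have hTm : Set.MapsTo T (simplexΔ d) (simplexΔ d) := fun y hy => update_mem_simplexΔ hy i
    rw [isOpen_simplexΔ.frontier_eq] at hx
    have hTx : T x ∈ frontier (simplexΔ d) := by
      rw [isOpen_simplexΔ.frontier_eq]
      refine ⟨map_mem_closure hTc hx.1 hTm, fun h => hx.2 ?_⟩
      have h2 : T (T x) = x := update_involutive i x
      exact h2 ▸ hTm h
    exact (hg.tendsto_atTop _ hTx).comp
      (tendsto_nhdsWithin_of_tendsto_nhds_of_eventually_within _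
        (hTc.continuousAt.tendsto.mono_left nhdsWithin_le_nhds)
        (eventually_nhdsWithin_of_forall hTm))

lemma lower_bound_swap (hg : IsBarrierSolution g) {x : Fin d → ℝ} (hx : x ∈ simplexΔ d)
    (i : Fin d) :
    -2 * (∑ j ∈ Finset.univ.erase i, Real.log (x j) + Real.log (1 - ∑ j, x j)) ≤ g x := by
  have h := (hg.comp_swap i).lower_bound (update_mem_simplexΔ hx i)
  simp only [vertexSwap_affine, update_involutive i x] at h
  rw [← Finset.add_sum_erase _ _ (Finset.mem_univ i), Function.update_self] at h
  have h2 : ∑ j ∈ Finset.univ.erase i, Real.log (Function.update x i (1 - ∑ j, x j) j)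
      = ∑ j ∈ Finset.univ.erase i, Real.log (x j) :=
    Finset.sum_congr rfl fun j hj => by rw [Function.update_of_ne (Finset.ne_of_mem_erase hj)]
  rw [h2] at h
  linarith

lemma mul_dirDeriv_le_two (hg : IsBarrierSolution g) {x : Fin d → ℝ} (hx : x ∈ simplexΔ d)
    (i : Fin d) : (1 - ∑ j, x j) * dirDeriv (Pi.single i 1) g x ≤ 2 := by
  have hy := update_mem_simplexΔ hx i
  have h := (hg.comp_swap i).neg_two_le_mul_dirDeriv hy i
  rw [dirDeriv_comp_affine hg.contDiffOn (vertexSwap_affine_mem i) _ hy] at h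
  have hv : (vertexSwap i).mulVec (Pi.single i 1) = -Pi.single i 1 := by
    rw [vertexSwap_mulVec]
    ext k
    by_cases hk : k = i
    · subst hk
      simp
    · simp [hk]
  simp only [vertexSwap_affine, update_involutive i x, Function.update_self] at h
  rw [hv] at h
  simp only [dirDeriv, map_neg] at h ⊢
  linarith

/-- Upper bound away from the faces `xᵢ = 0` and `∑ xⱼ = 1`. -/
lemma exists_upper_bound_log (hg : IsBarrierSolution g) (i : Fin d) {c : ℝ} (hc : 0 < c) :
    ∃ R, ∀ x ∈ simplexΔ d, c ≤ x i → c ≤ 1 - ∑ j, x j →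
      g x ≤ -2 * ∑ j ∈ Finset.univ.erase i, Real.log (x j) + R := by
  have hd : (0 : ℝ) < d := by
    have := i.pos
    exact_mod_cast this
  have hcd : 0 < c / (2 * d) := by positivity
  have hle : c / (2 * d) ≤ c / 2 := by
    have : (1 : ℝ) ≤ d := by
      have := i.pos
      exact_mod_cast this
    gcongr
    linarith
  obtain ⟨R, hR⟩ := hg.exists_upper_bound hcd
  refine ⟨R - 2 * Real.log c, fun x hx hxi hxs => ?_⟩
  have hy0 : ∀ j, 0 < x j + c / (2 * d) := fun j => add_pos (hx.1 j) hcd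
  have hsum : ∑ j, (x j + c / (2 * d)) = ∑ j, x j + c / 2 := by
    simp only [Finset.sum_add_distrib, Finset.sum_const, Finset.card_univ, Fintype.card_fin,
      nsmul_eq_mul]
    field_simp
  have hy1 : c / (2 * d) ≤ 1 - ∑ j, (x j + c / (2 * d)) := by
    rw [hsum]
    linarith
  have hy : (fun j => x j + c / (2 * d)) ∈ simplexΔ d := ⟨hy0, by
    have : ∑ j, (x j + c / (2 * d)) < 1 := by linarith
    exact this⟩
  have h1 := hg.scale_le (θ := fun j => x j / (x j + c / (2 * d)))
    (fun j => div_pos (hx.1 j) (hy0 j)) (fun j => (div_le_one (hy0 j)).2 (by linarith)) hy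
  have h2 : (fun j => x j / (x j + c / (2 * d)) * (x j + c / (2 * d))) = x :=
    funext fun j => div_mul_cancel₀ _ (hy0 j).ne'
  simp only [h2] at h1
  have h3 := hR _ (fun j => by linarith [hx.1 j]) hy1
  have h4 : ∑ j, Real.log (x j) ≤ ∑ j, Real.log (x j / (x j + c / (2 * d))) := by
    refine Finset.sum_le_sum fun j _ => Real.log_le_log (hx.1 j) ?_
    rw [le_div_iff₀ (hy0 j)]
    have h5 : x j + c / (2 * d) ≤ 1 := by
      have := simplexΔ.lt_one hy j
      exact this.le
    nlinarith [hx.1 j]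
  rw [← Finset.add_sum_erase _ _ (Finset.mem_univ i)] at h4
  have h6 : Real.log c ≤ Real.log (x i) := Real.log_le_log hc hxi
  linarith

end IsBarrierSolution

section Pogorelov

/-- The algebraic inequality extracted from the first and second order optimality conditions for
Pogorelov's auxiliary function. -/
lemma sq_le_of_optimality {ι : Type*} [Fintype ι] {η H K : ℝ} (hη : 0 < η) (hH : 0 < H)
    {t e q Q : ι → ℝ} {N : ι → ι → ℝ} (hN : ∀ i j, N i j = N j i)
    (hHt : H = ∑ i, t i ^ 2) (hq : ∀ i, q i = ∑ j, t j * N i j) (hte : ∑ i, t i * e i = -K)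
    (hK : K = ∑ i, N i i) (hQ : ∑ i, Q i = H + ∑ i, ∑ j, N i j ^ 2)
    (h1 : ∀ i, e i / η + q i / H + K * t i = 0)
    (h2 : ∀ i, -1 / η - e i ^ 2 / η ^ 2 + (Q i / H - q i ^ 2 / H ^ 2) + t i ^ 2 + K * N i i ≤ 0) :
    (η * H) ^ 2 ≤ Fintype.card ι * (η * H) + K ^ 2 := by
  set s := ∑ i, t i * q i with hs
  set m := ∑ i, q i ^ 2 with hm
  have hsum := Finset.sum_nonpos fun i (_ : i ∈ Finset.univ) => h2 i
  simp only [Finset.sum_add_distrib, Finset.sum_sub_distrib, ← Finset.sum_div, ← Finset.mul_sum,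
    Finset.sum_const, Finset.card_univ, nsmul_eq_mul, hQ, ← hHt, ← hK, ← hm] at hsum
  have hcol : ∀ j, ∑ i, t i * (N i j - q i * t j / H) = q j - s * t j / H := fun j => by
    simp only [mul_sub, Finset.sum_sub_distrib, hq j, hs, Finset.sum_mul, Finset.sum_div]
    congr 1
    · exact Finset.sum_congr rfl fun i _ => by rw [hN i j]
    · exact Finset.sum_congr rfl fun i _ => by ring
  have hcs : ∀ j, (q j - s * t j / H) ^ 2 ≤ H * ∑ i, (N i j - q i * t j / H) ^ 2 := fun j => by
    rw [← hcol j, hHt]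
    exact Finset.sum_mul_sq_le_sq_mul_sq _ _ _
  have hrow : ∀ i, ∑ j, (N i j - q i * t j / H) ^ 2 = ∑ j, N i j ^ 2 - q i ^ 2 / H := fun i => by
    have : ∀ j, (N i j - q i * t j / H) ^ 2
        = N i j ^ 2 - 2 * q i / H * (t j * N i j) + (q i / H) ^ 2 * t j ^ 2 := fun j => by ring
    simp only [this, Finset.sum_add_distrib, Finset.sum_sub_distrib, ← Finset.mul_sum, ← hq i,
      ← hHt]
    field_simp
    ring
  have hl : ∑ j, (q j - s * t j / H) ^ 2 = m - s ^ 2 / H := by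
    have : ∀ j, (q j - s * t j / H) ^ 2
        = q j ^ 2 - 2 * s / H * (t j * q j) + (s / H) ^ 2 * t j ^ 2 := fun j => by ring
    simp only [this, Finset.sum_add_distrib, Finset.sum_sub_distrib, ← Finset.mul_sum, ← hs,
      ← hm, ← hHt]
    field_simp
    ring
  have hNN : m - s ^ 2 / H ≤ H * (∑ i, ∑ j, N i j ^ 2 - m / H) := by
    have h := Finset.sum_le_sum fun j (_ : j ∈ Finset.univ) => hcs j
    rw [hl, ← Finset.mul_sum, Finset.sum_comm] at h
    simpa only [hrow, Finset.sum_sub_distrib, ← Finset.sum_div, ← hm] using h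
  have he : ∀ i, e i ^ 2 = η ^ 2 * (q i ^ 2 / H ^ 2 + 2 * K / H * (t i * q i) + K ^ 2 * t i ^ 2) :=
    fun i => by
    have : e i = -η * (q i / H + K * t i) := by
      have := h1 i
      field_simp at this ⊢
      linarith
    rw [this]
    ring
  have hesum : ∑ i, e i ^ 2 = η ^ 2 * (m / H ^ 2 + 2 * K / H * s + K ^ 2 * H) := by
    simp only [he, ← Finset.mul_sum, Finset.sum_add_distrib, ← Finset.sum_div, ← hs, ← hm, ← hHt]
  have hs2 : s = K * H / η - K * H ^ 2 := by
    have h : ∀ i, t i * e i = -η * (t i * q i / H + K * t i ^ 2) := fun i => by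
      have := h1 i
      field_simp at this ⊢
      linear_combination t i * this
    simp only [h, ← Finset.mul_sum, Finset.sum_add_distrib, ← Finset.sum_div, ← hs, ← hHt] at hte
    field_simp at hte ⊢
    linarith
  rw [hesum] at hsum
  set S := ∑ i, ∑ j, N i j ^ 2
  have hS : 2 * m / H ^ 2 - s ^ 2 / H ^ 3 ≤ S / H := by
    rw [← sub_nonneg] at hNN ⊢
    have : S / H - (2 * m / H ^ 2 - s ^ 2 / H ^ 3)
      = (H * (S - m / H) - (m - s ^ 2 / H)) / H ^ 2 := by
      field_simp
      ring
    rw [this]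
    positivity
  have hfin : 1 + H + K ^ 2 - Fintype.card ι / η - K ^ 2 / (η ^ 2 * H) ≤ 0 := by
    refine le_trans (le_of_eq ?_) (hsum.trans' (add_le_add_left (add_le_add_left
      (add_le_add_right (sub_le_sub_right (div_le_div_of_nonneg_right
      (add_le_add_right (show H * (2 * m / H ^ 2 - s ^ 2 / H ^ 3) ≤ S from ?_) H) hH.le) _) _) _) _))
    · rw [hs2]
      field_simp
      ring
    · rwa [← le_div_iff₀' hH]
  have : (η * H) ^ 2 - (Fintype.card ι * (η * H) + K ^ 2)
      = η ^ 2 * H * (1 + H + K ^ 2 - Fintype.card ι / η - K ^ 2 / (η ^ 2 * H))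
        - η ^ 2 * H * (1 + K ^ 2) := by
    field_simp
    ring
  rw [← sub_nonpos, this]
  have h3 := mul_nonpos_of_nonneg_of_nonpos (by positivity : 0 ≤ η ^ 2 * H) hfin
  have h4 : 0 ≤ η ^ 2 * H * (1 + K ^ 2) := by positivity
  linarith

end Pogorelov

lemma dirDeriv_rotate {S : Set (Fin d → ℝ)} (hS : IsOpen S) {f : (Fin d → ℝ) → ℝ}
    (hf : ContDiffOn ℝ ∞ f S) (u v w : Fin d → ℝ) :
    Set.EqOn (dirDeriv u (dirDeriv v (dirDeriv w f))) (dirDeriv v (dirDeriv w (dirDeriv u f))) S :=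
  fun x hx => by
    rw [dirDeriv_comm hS (hf.dirDeriv hS w) u v hx]
    exact dirDeriv_congr hS (dirDeriv_comm hS hf u w) v hx

namespace IsBarrierSolution

variable {g : (Fin d → ℝ) → ℝ}

/-- The equation differentiated once and twice in the direction `v`, in a frame which is
orthonormal for the Hessian at `z`. -/
lemma exists_frame_linearized (hg : IsBarrierSolution g) {z : Fin d → ℝ} (hz : z ∈ simplexΔ d)
    (v : Fin d → ℝ) :
    ∃ (f : Fin d → Fin d → ℝ) (t : Fin d → ℝ), v = ∑ j, t j • f j ∧
      (∀ i j, dirDeriv (f i) (dirDeriv (f j) g) z = if i = j then 1 else 0) ∧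
      dirDeriv v g z = ∑ i, dirDeriv (f i) (dirDeriv (f i) (dirDeriv v g)) z ∧
      ∑ i, dirDeriv (f i) (dirDeriv (f i) (dirDeriv v (dirDeriv v g))) z
        = dirDeriv v (dirDeriv v g) z
          + ∑ i, ∑ j, dirDeriv (f i) (dirDeriv (f j) (dirDeriv v g)) z ^ 2 := by
  have hS := isOpen_simplexΔ (d := d)
  have hgc := hg.contDiffOn
  obtain ⟨F, hF, hFA⟩ := (hg.posDef z hz).exists_frame
  have hdetF : IsUnit F.det := (Matrix.isUnit_iff_isUnit_det F).1 hF
  set f : Fin d → Fin d → ℝ := fun j k => F k j with hf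
  have hB : ∀ y ∈ simplexΔ d, ∀ i j,
      dirDeriv (f i) (dirDeriv (f j) g) y = (Fᵀ * hess d g y * F) i j := fun y hy i j => by
    rw [dirDeriv_dirDeriv_eq_hess hS hgc hy]
    simp only [hf, Matrix.mul_apply, dotProduct, Matrix.mulVec, Matrix.transpose_apply,
      Finset.mul_sum, Finset.sum_mul]
    rw [Finset.sum_comm]
    exact Finset.sum_congr rfl fun k _ => Finset.sum_congr rfl fun l _ => by ring
  have hz0 : z + (0 : ℝ) • v ∈ simplexΔ d := by simpa using hz
  have hline : ∀ᶠ s in 𝓝 (0 : ℝ), z + s • v ∈ simplexΔ d :=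
    (by fun_prop : Continuous fun s : ℝ => z + s • v).continuousAt.eventually
      (hS.mem_nhds hz0)
  obtain ⟨φ, hφ, hφ0, hφ'⟩ := Matrix.exists_hasDerivAt_log_det
    (B := fun s => Matrix.of fun i j => dirDeriv (f i) (dirDeriv (f j) g) (z + s • v))
    (B' := fun s => Matrix.of fun i j =>
      dirDeriv v (dirDeriv (f i) (dirDeriv (f j) g)) (z + s • v))
    (B'' := Matrix.of fun i j => dirDeriv v (dirDeriv v (dirDeriv (f i) (dirDeriv (f j) g))) z)
    (by
      ext i j
      simp only [Matrix.of_apply, zero_smul, add_zero, hB z hz, hFA])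
    (hline.mono fun s hs i j =>
      ((hgc.dirDeriv hS (f j)).dirDeriv hS (f i)).hasDerivAt_line hS z v hs)
    (fun i j => by
      simpa using
        (((hgc.dirDeriv hS (f j)).dirDeriv hS (f i)).dirDeriv hS v).hasDerivAt_line hS z v hz0)
  have hlog : ∀ᶠ s in 𝓝 (0 : ℝ), Real.log (Matrix.of fun i j =>
      dirDeriv (f i) (dirDeriv (f j) g) (z + s • v)).det
        = g (z + s • v) + (Real.log (F.det ^ 2) - Real.log ((2 : ℝ)⁻¹ ^ d)) := by
    filter_upwards [hline] with s hs
    have h1 : (Matrix.of fun i j => dirDeriv (f i) (dirDeriv (f j) g) (z + s • v))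
        = Fᵀ * hess d g (z + s • v) * F := by
      ext i j
      exact hB _ hs i j
    have h2 := (hg.posDef _ hs).det_pos
    rw [h1, Matrix.det_mul, Matrix.det_mul, Matrix.det_transpose, hg.eq_log_det _ hs,
      Matrix.det_smul, Fintype.card_fin, Real.log_mul (by positivity) h2.ne',
      show F.det * (hess d g (z + s • v)).det * F.det = F.det ^ 2 * (hess d g (z + s • v)).det by
        ring, Real.log_mul (pow_ne_zero 2 hdetF.ne_zero) h2.ne']
    ring
  have hφg : φ =ᶠ[𝓝 0] fun s => dirDeriv v g (z + s • v) := by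
    filter_upwards [hφ, hlog.eventually_nhds, hline] with s h1 h2 h3
    exact (h1.congr_of_eventuallyEq (EventuallyEq.symm h2)).unique
      ((hgc.hasDerivAt_line hS z v h3).add_const _)
  have hφ2 := (hφ'.congr_of_eventuallyEq hφg.symm).unique
    ((hgc.dirDeriv hS v).hasDerivAt_line hS z v hz0)
  have hφ1 := hφg.self_of_nhds
  rw [hφ0] at hφ1
  have hrot1 : ∀ i j, dirDeriv v (dirDeriv (f i) (dirDeriv (f j) g)) z
      = dirDeriv (f i) (dirDeriv (f j) (dirDeriv v g)) z := fun i j =>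
    dirDeriv_rotate hS hgc _ _ _ hz
  have hrot2 : ∀ i j, dirDeriv v (dirDeriv v (dirDeriv (f i) (dirDeriv (f j) g))) z
      = dirDeriv (f i) (dirDeriv (f j) (dirDeriv v (dirDeriv v g))) z := fun i j => by
    rw [dirDeriv_congr hS (dirDeriv_rotate hS hgc v (f i) (f j)) v hz]
    exact dirDeriv_rotate hS (hgc.dirDeriv hS v) _ _ _ hz
  have hsymm : ∀ i j, dirDeriv (f i) (dirDeriv (f j) (dirDeriv v g)) z
      = dirDeriv (f j) (dirDeriv (f i) (dirDeriv v g)) z := fun i j =>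
    dirDeriv_comm hS (hgc.dirDeriv hS v) _ _ hz
  simp only [Matrix.trace, Matrix.diag, Matrix.mul_apply, Matrix.of_apply, zero_smul, add_zero,
    hrot1, hrot2] at hφ1 hφ2
  refine ⟨f, F⁻¹.mulVec v, ?_, fun i j => ?_, hφ1.symm, ?_⟩
  · have h : F.mulVec (F⁻¹.mulVec v) = v := by
      rw [Matrix.mulVec_mulVec, Matrix.mul_nonsing_inv _ hdetF, Matrix.one_mulVec]
    conv_lhs => rw [← h]
    ext k
    simp only [hf, Matrix.mulVec, dotProduct, Finset.sum_apply, Pi.smul_apply, smul_eq_mul]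
    exact Finset.sum_congr rfl fun j _ => mul_comm _ _
  · rw [hB z hz, hFA, Matrix.one_apply]
  · rw [← hφ2, sub_add_eq_add_sub, eq_sub_iff_add_eq, add_right_inj]
    exact Finset.sum_congr rfl fun i _ => Finset.sum_congr rfl fun j _ => by
      rw [sq, hsymm j i]

/-- Pogorelov's interior estimate: where `g` lies at least `1` below an affine function which is
constant in the direction `v`, the second derivative of `g` in the direction `v` is controlled by
the first one on the section cut off by this affine function. -/
lemma pogorelov (hg : IsBarrierSolution g) {v : Fin d → ℝ} (hv : v ≠ 0) {a : ℝ} {m : Fin d → ℝ}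
    (hmv : m ⬝ᵥ v = 0) {G : ℝ} (hG : 0 ≤ G)
    (hgrad : ∀ y ∈ simplexΔ d, g y < a + m ⬝ᵥ y → |dirDeriv v g y| ≤ G) {x : Fin d → ℝ}
    (hx : x ∈ simplexΔ d) (hx1 : g x + 1 ≤ a + m ⬝ᵥ x) :
    dirDeriv v (dirDeriv v g) x ≤ (d + G) * Real.exp (G ^ 2 / 2) := by
  have hS := isOpen_simplexΔ (d := d)
  have hgc := hg.contDiffOn
  set K := dirDeriv v g with hKdef
  set H := dirDeriv v K with hHdef
  have hKc : ContDiffOn ℝ ∞ K (simplexΔ d) := hgc.dirDeriv hS v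
  have hHc : ContDiffOn ℝ ∞ H (simplexΔ d) := hKc.dirDeriv hS v
  have hHpos : ∀ y ∈ simplexΔ d, 0 < H y := fun y hy => by
    rw [hHdef, hKdef, dirDeriv_dirDeriv_eq_hess hS hgc hy]
    simpa using (hg.posDef y hy).dotProduct_mulVec_pos hv
  have hlin : ContDiffOn ℝ ∞ (fun y => a + m ⬝ᵥ y) (simplexΔ d) := by
    simp only [dotProduct]
    fun_prop
  set η : (Fin d → ℝ) → ℝ := fun y => a + m ⬝ᵥ y - g y with hηdef
  have hηc : ContDiffOn ℝ ∞ η (simplexΔ d) := hlin.sub hgc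
  set P : (Fin d → ℝ) → ℝ := fun y => η y * H y * Real.exp (K y ^ 2 / 2) with hPdef
  have hPc : ContinuousOn P (simplexΔ d) :=
    (hηc.continuousOn.mul hHc.continuousOn).mul ((hKc.continuousOn.pow 2).div_const 2).rexp
  set R := a + ∑ i, |m i| with hR
  have hlR : ∀ y ∈ simplexΔ d, a + m ⬝ᵥ y ≤ R := fun y hy => by
    rw [hR, dotProduct]
    gcongr with i
    calc m i * y i ≤ |m i| * y i := mul_le_mul_of_nonneg_right (le_abs_self _) (hy.1 i).le
      _ ≤ |m i| * 1 := mul_le_mul_of_nonneg_left (simplexΔ.lt_one hy i).le (abs_nonneg _)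
      _ = |m i| := mul_one _
  have hxR : g x ≤ R := by linarith [hlR x hx]
  obtain ⟨z, hz, hmax⟩ := (hg.isCompact_sublevel R).exists_isMaxOn ⟨x, hx, hxR⟩
    (hPc.mono fun y hy => hy.1)
  replace hz : z ∈ simplexΔ d := hz.1
  have hηx : 1 ≤ η x := by
    simp only [hηdef]
    linarith
  have hHx : H x ≤ P x := by
    have h1 : H x ≤ η x * H x := le_mul_of_one_le_left (hHpos x hx).le hηx
    refine h1.trans (le_mul_of_one_le_right ?_ (Real.one_le_exp (by positivity)))
    exact mul_nonneg (zero_le_one.trans hηx) (hHpos x hx).le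
  have hPx : P x ≤ P z := hmax ⟨hx, hxR⟩
  have hPz : 0 < P z := (hHpos x hx).trans_le (hHx.trans hPx)
  have hηz : 0 < η z := by
    have h1 := pos_of_mul_pos_left hPz (Real.exp_pos _).le
    exact pos_of_mul_pos_left h1 (hHpos z hz).le
  have hglob : ∀ y ∈ simplexΔ d, P y ≤ P z := fun y hy => by
    by_cases hyR : g y ≤ R
    · exact hmax ⟨hy, hyR⟩
    · refine le_trans ?_ hPz.le
      refine mul_nonpos_of_nonpos_of_nonneg
        (mul_nonpos_of_nonpos_of_nonneg ?_ (hHpos y hy).le) (Real.exp_pos _).le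
      simp only [hηdef]
      linarith [hlR y hy, not_le.1 hyR]
  obtain ⟨f, t, hvt, hframe, hlin1, hlin2⟩ := hg.exists_frame_linearized hz v
  set N : Fin d → Fin d → ℝ := fun i j => dirDeriv (f i) (dirDeriv (f j) K) z with hNdef
  have hk : ∀ i, dirDeriv (f i) K z = t i := fun i => by
    have h := dirDeriv_dirDeriv_sum hS hgc hz Finset.univ t f (f i)
    rw [← hvt] at h
    rw [hKdef, h]
    simp [hframe]
  have hq : ∀ i, dirDeriv (f i) H z = ∑ j, t j * N i j := fun i => by
    have h := dirDeriv_dirDeriv_sum hS hKc hz Finset.univ t f (f i)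
    rwa [← hvt] at h
  have hHt : H z = ∑ i, t i ^ 2 := by
    have h := dirDeriv_sum Finset.univ t f K z
    rw [← hvt] at h
    rw [hHdef, h]
    exact Finset.sum_congr rfl fun i _ => by rw [hk, sq]
  have hte : ∑ i, t i * (m ⬝ᵥ f i - dirDeriv (f i) g z) = -K z := by
    have h := dirDeriv_sum Finset.univ t f g z
    rw [← hvt] at h
    have h2 : ∑ i, t i * (m ⬝ᵥ f i) = 0 := by
      rw [← hmv]
      conv_rhs => rw [hvt]
      simp [dotProduct_sum, dotProduct_smul]
    simp only [mul_sub, Finset.sum_sub_distrib, h2, ← h]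
    simp [hKdef]
  have hopt : ∀ i,
      (m ⬝ᵥ f i - dirDeriv (f i) g z) / η z + dirDeriv (f i) H z / H z + K z * t i = 0 ∧
      -1 / η z - (m ⬝ᵥ f i - dirDeriv (f i) g z) ^ 2 / η z ^ 2
        + (dirDeriv (f i) (dirDeriv (f i) H) z / H z - dirDeriv (f i) H z ^ 2 / H z ^ 2)
        + t i ^ 2 + K z * N i i ≤ 0 := fun i => by
    have hz0 : z + (0 : ℝ) • f i ∈ simplexΔ d := by simpa using hz
    have hline : ∀ᶠ s in 𝓝 (0 : ℝ), z + s • f i ∈ simplexΔ d :=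
      (by fun_prop : Continuous fun s : ℝ => z + s • f i).continuousAt.eventually
        (hS.mem_nhds hz0)
    have hη1 : ∀ s : ℝ, z + s • f i ∈ simplexΔ d → HasDerivAt (fun s : ℝ => η (z + s • f i))
        (m ⬝ᵥ f i - dirDeriv (f i) g (z + s • f i)) s := fun s hs => by
      refine HasDerivAt.sub ?_ (hgc.hasDerivAt_line hS z (f i) hs)
      have h : (fun s : ℝ => a + m ⬝ᵥ (z + s • f i)) = fun s => (a + m ⬝ᵥ z) + s * (m ⬝ᵥ f i) := by
        funext s
        rw [dotProduct_add, dotProduct_smul, smul_eq_mul]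
        ring
      rw [h]
      simpa using ((hasDerivAt_id s).mul_const (m ⬝ᵥ f i)).const_add (a + m ⬝ᵥ z)
    have hηpos : ∀ᶠ s in 𝓝 (0 : ℝ), 0 < η (z + s • f i) :=
      (hη1 0 hz0).continuousAt.eventually (lt_mem_nhds (by simpa using hηz))
    have hlocmax : IsLocalMax (fun s : ℝ => Real.log (η (z + s • f i))
        + Real.log (H (z + s • f i)) + K (z + s • f i) ^ 2 / 2) 0 := by
      have hlogP : ∀ y ∈ simplexΔ d, 0 < η y →
          Real.log (P y) = Real.log (η y) + Real.log (H y) + K y ^ 2 / 2 := fun y hy hη => by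
        have h := hHpos y hy
        rw [hPdef]
        simp only
        rw [Real.log_mul (mul_pos hη h).ne' (Real.exp_pos _).ne', Real.log_mul hη.ne' h.ne',
          Real.log_exp]
      filter_upwards [hline, hηpos] with s hs hs2
      simp only [zero_smul, add_zero]
      rw [← hlogP _ hs hs2, ← hlogP z hz hηz]
      exact Real.log_le_log (mul_pos (mul_pos hs2 (hHpos _ hs)) (Real.exp_pos _)) (hglob _ hs)
    have hK0 := hKc.hasDerivAt_line hS z (f i) hz0
    have hK1 := (hKc.dirDeriv hS (f i)).hasDerivAt_line hS z (f i) hz0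
    have hH0 := hHc.hasDerivAt_line hS z (f i) hz0
    have hH1 := (hHc.dirDeriv hS (f i)).hasDerivAt_line hS z (f i) hz0
    have hg1 := (hgc.dirDeriv hS (f i)).hasDerivAt_line hS z (f i) hz0
    have h := hlocmax.second_deriv_nonpos
      (w' := fun s => (m ⬝ᵥ f i - dirDeriv (f i) g (z + s • f i)) / η (z + s • f i)
        + dirDeriv (f i) H (z + s • f i) / H (z + s • f i)
        + K (z + s • f i) * dirDeriv (f i) K (z + s • f i))
      (by
        filter_upwards [hline, hηpos] with s hs hs2
        refine (((hη1 s hs).log hs2.ne').add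
          ((hHc.hasDerivAt_line hS z (f i) hs).log (hHpos _ hs).ne')).add ?_
        refine (((hKc.hasDerivAt_line hS z (f i) hs).pow 2).div_const 2).congr_deriv ?_
        push_cast
        ring)
      ((((hg1.const_sub _).div (hη1 0 hz0) (by simpa using hηz.ne')).add
        (hH1.div hH0 (by simpa using (hHpos z hz).ne'))).add (hK0.mul hK1))
    simp only [zero_smul, add_zero, hk, hframe, if_true] at h
    refine ⟨h.1, le_trans (le_of_eq ?_) h.2⟩
    have := hηz.ne'
    have := (hHpos z hz).ne'
    field_simp
    ring
  have hmain := sq_le_of_optimality hηz (hHpos z hz)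
    (fun i j => dirDeriv_comm hS hKc (f i) (f j) hz) hHt hq hte hlin1 hlin2
    (fun i => (hopt i).1) (fun i => (hopt i).2)
  rw [Fintype.card_fin] at hmain
  have hKz : |K z| ≤ G := hgrad z hz (by simpa [hηdef] using hηz)
  have hKz2 : K z ^ 2 ≤ G ^ 2 := sq_le_sq' (abs_le.1 hKz).1 (abs_le.1 hKz).2
  have hQ : η z * H z ≤ d + G := by
    by_contra! h
    have hd : (0 : ℝ) ≤ d := Nat.cast_nonneg d
    nlinarith
  refine (hHx.trans hPx).trans ?_
  simp only [hPdef]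
  gcongr

/-- The pure second derivative of `g` in the direction `eᵢ` is bounded away from the faces
`xᵢ = 0` and `∑ xⱼ = 1`, uniformly up to the other faces. -/
lemma exists_second_dirDeriv_le (hg : IsBarrierSolution g) (i : Fin d) {c : ℝ} (hc : 0 < c) :
    ∃ C, ∀ x ∈ simplexΔ d, c ≤ x i → c ≤ 1 - ∑ j, x j →
      dirDeriv (Pi.single i 1) (dirDeriv (Pi.single i 1) g) x ≤ C := by
  obtain ⟨R, hR⟩ := hg.exists_upper_bound_log i hc
  set E := Real.exp (-(R + 1) / 2) with hE
  have hE0 : 0 < E := Real.exp_pos _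
  refine ⟨(d + 2 / E) * Real.exp ((2 / E) ^ 2 / 2), fun x hx hxi hxs => ?_⟩
  set m : Fin d → ℝ := fun j => if j = i then 0 else -2 / x j with hm
  set a : ℝ := ∑ j ∈ Finset.univ.erase i, (-2 * Real.log (x j) + 2) + (R + 1) with ha
  have hmy : ∀ y : Fin d → ℝ, m ⬝ᵥ y = ∑ j ∈ Finset.univ.erase i, -2 / x j * y j := fun y => by
    rw [dotProduct, ← Finset.add_sum_erase _ _ (Finset.mem_univ i)]
    simp only [hm, if_true, zero_mul, zero_add]
    exact Finset.sum_congr rfl fun j hj => by rw [if_neg (Finset.ne_of_mem_erase hj)]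
  have hay : ∀ y ∈ simplexΔ d,
      a + m ⬝ᵥ y ≤ -2 * ∑ j ∈ Finset.univ.erase i, Real.log (y j) + (R + 1) := fun y hy => by
    rw [hmy, ha, add_right_comm, ← Finset.sum_add_distrib, Finset.mul_sum]
    gcongr with j
    have h := Real.log_le_sub_one_of_pos (div_pos (hy.1 j) (hx.1 j))
    rw [Real.log_div (hy.1 j).ne' (hx.1 j).ne'] at h
    have h2 : -2 / x j * y j = -2 * (y j / x j) := by ring
    linarith
  have hexp : ∀ r : ℝ, 0 < r → -2 * Real.log r < R + 1 → E < r := fun r hr h => by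
    rw [hE, ← Real.lt_log_iff_exp_lt hr]
    linarith
  refine hg.pogorelov (v := Pi.single i 1) (a := a) (m := m) ?_ ?_ (by positivity) ?_ hx ?_
  · simp
  · simp [hm]
  · intro y hy hgy
    have h := hay y hy
    have h1 : E < y i := hexp _ (hy.1 i) <| by
      have := hg.lower_bound hy
      rw [← Finset.add_sum_erase _ _ (Finset.mem_univ i)] at this
      linarith
    have h2 : E < 1 - ∑ j, y j := hexp _ (sub_pos.2 hy.2) <| by
      have := hg.lower_bound_swap hy i
      linarith
    have h3 := hg.neg_two_le_mul_dirDeriv hy i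
    have h4 := hg.mul_dirDeriv_le_two hy i
    rw [abs_le, ← neg_div, div_le_iff₀ hE0, le_div_iff₀ hE0]
    constructor <;> nlinarith
  · have h : m ⬝ᵥ x = ∑ j ∈ Finset.univ.erase i, (-2 : ℝ) := by
      rw [hmy]
      exact Finset.sum_congr rfl fun j _ => div_mul_cancel₀ _ (hx.1 j).ne'
    rw [h, ha, add_right_comm, ← Finset.sum_add_distrib]
    simp only [add_assoc, add_neg_cancel, add_zero, ← Finset.mul_sum]
    linarith [hR x hx hxi hxs]

end IsBarrierSolution

lemma sum_sq_mul_lamMin_le {A : Matrix (Fin d) (Fin d) ℝ} (hA : A.PosDef) (w : Fin d → ℝ) :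
    (∑ i, w i ^ 2) * lamMin d A ≤ w ⬝ᵥ A.mulVec w := by
  have hnn : ∀ v : Fin d → ℝ, 0 ≤ v ⬝ᵥ A.mulVec v := fun v => by
    simpa using hA.posSemidef.dotProduct_mulVec_nonneg v
  obtain h0 | hpos := (Finset.sum_nonneg fun i (_ : i ∈ Finset.univ) => sq_nonneg (w i)).eq_or_lt
  · rw [← h0, zero_mul]
    exact hnn w
  · set s := ∑ i, w i ^ 2 with hs
    have hs2 : (√s)⁻¹ ^ 2 = s⁻¹ := by rw [inv_pow, Real.sq_sqrt hpos.le]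
    have h : lamMin d A ≤ s⁻¹ * (w ⬝ᵥ A.mulVec w) := by
      refine csInf_le ⟨0, ?_⟩ ⟨(√s)⁻¹ • w, ?_, ?_⟩
      · rintro r ⟨v, -, rfl⟩
        exact hnn v
      · simp only [Pi.smul_apply, smul_eq_mul, mul_pow, ← Finset.mul_sum, hs2, ← hs]
        exact inv_mul_cancel₀ hpos.ne'
      · rw [Matrix.mulVec_smul, smul_dotProduct, dotProduct_smul, smul_eq_mul, smul_eq_mul,
          ← mul_assoc, ← sq, hs2]
    rwa [inv_mul_eq_div, le_div_iff₀' hpos] at h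

namespace IsBarrierSolution

variable {g : (Fin d → ℝ) → ℝ}

lemma exists_lamMin_le (hg : IsBarrierSolution g) (i : Fin d) {c : ℝ} (hc : 0 < c) :
    ∃ C, ∀ x ∈ simplexΔ d, c ≤ x i → c ≤ 1 - ∑ j, x j → lamMin d (hess d g x) ≤ C := by
  obtain ⟨C, hC⟩ := hg.exists_second_dirDeriv_le i hc
  refine ⟨C, fun x hx hxi hxs => ?_⟩
  have h := hC x hx hxi hxs
  rw [dirDeriv_dirDeriv_eq_hess isOpen_simplexΔ hg.contDiffOn hx] at h
  have h2 := sum_sq_mul_lamMin_le (hg.posDef x hx) (Pi.single i 1)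
  have h3 : ∑ k, (Pi.single i 1 : Fin d → ℝ) k ^ 2 = 1 := by
    simp [Pi.single_apply, ite_pow]
  rw [h3, one_mul] at h2
  exact h2.trans h

lemma exists_lamMin_le' (hg : IsBarrierSolution g) {i j : Fin d} (hij : i ≠ j) {c : ℝ}
    (hc : 0 < c) :
    ∃ C, ∀ x ∈ simplexΔ d, c ≤ x i → c ≤ x j → lamMin d (hess d g x) ≤ C := by
  obtain ⟨C, hC⟩ := (hg.comp_swap j).exists_second_dirDeriv_le i hc
  refine ⟨C / 2, fun x hx hxi hxj => ?_⟩
  have hy := update_mem_simplexΔ hx j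
  have h := hC _ hy (by rwa [Function.update_of_ne hij]) (by
    rw [sum_update_eq]
    linarith)
  rw [dirDeriv_dirDeriv_comp_affine hg.contDiffOn (vertexSwap_affine_mem j) _ _ hy,
    vertexSwap_affine] at h
  have hinv := update_involutive j x
  simp only at hinv
  rw [hinv, dirDeriv_dirDeriv_eq_hess isOpen_simplexΔ hg.contDiffOn hx] at h
  have h2 := sum_sq_mul_lamMin_le (hg.posDef x hx) ((vertexSwap j).mulVec (Pi.single i 1))
  have h3 : ∑ k, (vertexSwap j).mulVec (Pi.single i 1) k ^ 2 = 2 := by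
    rw [vertexSwap_mulVec, ← Finset.add_sum_erase _ _ (Finset.mem_univ j),
      Finset.sum_eq_single_of_mem i (Finset.mem_erase.2 ⟨hij, Finset.mem_univ i⟩)]
    · simp [hij]
      norm_num
    · intro k hk hki
      simp [Finset.ne_of_mem_erase hk, hki]
  rw [h3] at h2
  linarith

lemma exists_eventually_lamMin_le (hg : IsBarrierSolution g) {x0 : Fin d → ℝ}
    (hx0 : x0 ∈ frontier (simplexΔ d)) (hvert₀ : x0 ≠ 0)
    (hvert : ∀ i : Fin d, x0 ≠ Pi.single i 1) :
    ∃ C, ∀ᶠ x in 𝓝 x0, x ∈ simplexΔ d → lamMin d (hess d g x) ≤ C := by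
  have hsub : simplexΔ d ⊆ {x : Fin d → ℝ | (∀ i, 0 ≤ x i) ∧ ∑ i, x i ≤ 1} := fun x hx =>
    ⟨fun i => (hx.1 i).le, hx.2.le⟩
  have hcl : x0 ∈ {x : Fin d → ℝ | (∀ i, 0 ≤ x i) ∧ ∑ i, x i ≤ 1} := by
    refine closure_minimal hsub ?_ (frontier_subset_closure hx0)
    simp only [Set.ofPred_and, Set.ofPred_forall]
    exact (isClosed_iInter fun i => isClosed_le continuous_const (continuous_apply i)).inter
      (isClosed_le (by fun_prop) continuous_const)
  obtain ⟨i, hi⟩ : ∃ i, 0 < x0 i := by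
    by_contra! h
    exact hvert₀ (funext fun i => le_antisymm (h i) (hcl.1 i))
  have hci : ∀ᶠ x in 𝓝 x0, x0 i / 2 < x i :=
    (continuous_apply i).continuousAt.eventually (lt_mem_nhds (half_lt_self hi))
  obtain hlt | heq := hcl.2.lt_or_eq
  · have hpos : 0 < 1 - ∑ k, x0 k := sub_pos.2 hlt
    have hcs : ∀ᶠ x in 𝓝 x0, (1 - ∑ k, x0 k) / 2 < 1 - ∑ k, x k :=
      (by fun_prop : Continuous fun x : Fin d → ℝ => 1 - ∑ k, x k).continuousAt.eventually
        (lt_mem_nhds (half_lt_self hpos))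
    obtain ⟨C, hC⟩ := hg.exists_lamMin_le i (lt_min (half_pos hi) (half_pos hpos))
    refine ⟨C, ?_⟩
    filter_upwards [hci, hcs] with x h1 h2 hx
    exact hC x hx ((min_le_left _ _).trans h1.le) ((min_le_right _ _).trans h2.le)
  · obtain ⟨j, hji, hj⟩ : ∃ j, j ≠ i ∧ 0 < x0 j := by
      by_contra! h
      have h0 : ∀ j, j ≠ i → x0 j = 0 := fun j hj => le_antisymm (h j hj) (hcl.1 j)
      rw [Finset.sum_eq_single i (fun j _ hj => h0 j hj) (by simp)] at heq
      refine hvert i (funext fun k => ?_)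
      by_cases hk : k = i
      · subst hk
        simpa using heq
      · simp [hk, h0 k hk]
    have hcj : ∀ᶠ x in 𝓝 x0, x0 j / 2 < x j :=
      (continuous_apply j).continuousAt.eventually (lt_mem_nhds (half_lt_self hj))
    obtain ⟨C, hC⟩ := hg.exists_lamMin_le' hji.symm (lt_min (half_pos hi) (half_pos hj))
    refine ⟨C, ?_⟩
    filter_upwards [hci, hcj] with x h1 h2 hx
    exact hC x hx ((min_le_left _ _).trans h1.le) ((min_le_right _ _).trans h2.le)

end IsBarrierSolution

end Simplex

/-- Near any non-vertex boundary point, the smallest eigenvalue of `∇²g` stays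
bounded. -/
theorem lambda_min_bounded_near_boundary (d : ℕ) (hd : 1 ≤ d) (g : (Fin d → ℝ) → ℝ)
    (hg : ContDiffOn ℝ (⊤ : ℕ∞) g (simplexΔ d))
    (hpos : ∀ x ∈ simplexΔ d, (hess d g x).PosDef)
    (hMA : ∀ x ∈ simplexΔ d, g x = Real.log (((2 : ℝ)⁻¹ • hess d g x).det))
    (hbd : ∀ x0 ∈ frontier (simplexΔ d),
      Filter.Tendsto g (nhdsWithin x0 (simplexΔ d)) Filter.atTop)
    (x0 : Fin d → ℝ) (hx0 : x0 ∈ frontier (simplexΔ d))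
    (hvert₀ : x0 ≠ 0) (hvert : ∀ i : Fin d, x0 ≠ Pi.single i 1) :
    ∃ C > (0 : ℝ), ∃ δ > (0 : ℝ), ∀ x ∈ simplexΔ d,
      Real.sqrt (∑ i, (x i - x0 i) ^ 2) < δ → lamMin d (hess d g x) ≤ C := by
  obtain ⟨C, hC⟩ := (IsBarrierSolution.mk hg hpos hMA hbd).exists_eventually_lamMin_le hx0 hvert₀
    hvert
  obtain ⟨δ, hδ, hball⟩ := Metric.eventually_nhds_iff.1 hC
  refine ⟨max C 1, lt_max_of_lt_right one_pos, δ, hδ, fun x hx hxδ => ?_⟩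
  refine (hball ((dist_pi_lt_iff hδ).2 fun i => ?_) hx).trans (le_max_left _ _)
  rw [Real.dist_eq, ← Real.sqrt_sq_eq_abs]
  refine (Real.sqrt_le_sqrt ?_).trans_lt hxδ
  exact Finset.single_le_sum (f := fun i => (x i - x0 i) ^ 2) (fun i _ => sq_nonneg _)
    (Finset.mem_univ i)
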